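/- Consider the linear ℤ/4ℤ-action on ℂ[z1,z2,w1,w2] induced by the substitution (z1,z2,w1,w2) ↦ (i·z1, z2, −i·w1, w2). The complex vector space of polynomials that are bihomogeneous of bidegree (2,2) (degree 2 in (z1,z2) and degree 2 in (w1,w2)) and invariant under this action is spanned by z1²w1², z2²w2² and z1z2w1w2. Moreover, every polynomial in this invariant space factors as a product of two bihomogeneous polynomials of bidegree (1,1). -/

import Mathlib

open MvPolynomial

theorem MvPolynomial.aeval_C_mul_X_monomial {σ R : Type*} [Fintype σ] [CommSemiring R]
    (u : σ → R) (d : σ →₀ ℕ) (c : R) :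
    aeval (fun i => C (u i) * X i : σ → MvPolynomial σ R) (monomial d c) =
      monomial d ((∏ i, u i ^ d i) * c) := by
  rw [aeval_monomial, monomial_eq, Finsupp.prod_fintype _ _ (by simp),
    Finsupp.prod_fintype _ _ (by simp)]
  simp only [mul_pow, Finset.prod_mul_distrib, algebraMap_eq, map_mul, map_prod, map_pow]
  ring

theorem MvPolynomial.coeff_aeval_C_mul_X {σ R : Type*} [Fintype σ] [CommSemiring R]
    (u : σ → R) (f : MvPolynomial σ R) (d : σ →₀ ℕ) :
    coeff d (aeval (fun i => C (u i) * X i : σ → MvPolynomial σ R) f) =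
      (∏ i, u i ^ d i) * coeff d f := by
  classical
  induction f using MvPolynomial.induction_on' with
  | monomial e c =>
    rw [aeval_C_mul_X_monomial, coeff_monomial, coeff_monomial]
    split_ifs with h <;> simp [h]
  | add p q hp hq => rw [map_add, coeff_add, hp, hq, coeff_add, mul_add]

theorem exists_mul_eq_binary_quadratic_form {K A : Type*} [Field K] [IsAlgClosed K]
    [CommRing A] [Algebra K A] (a b c : K) (x y : A) :
    ∃ p q r s : K, a • x ^ 2 + b • y ^ 2 + c • (x * y) =
      (p • x + q • y) * (r • x + s • y) := by
  by_cases ha : a = 0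
  · refine ⟨0, 1, c, b, ?_⟩
    simp only [ha, Algebra.smul_def, map_zero, map_one]
    ring
  · obtain ⟨t, ht⟩ := IsAlgClosed.exists_root
      (Polynomial.C a * Polynomial.X ^ 2 + Polynomial.C c * Polynomial.X + Polynomial.C b)
      (by rw [Polynomial.degree_quadratic ha]; decide)
    have hb : b = -(t * (c + a * t)) := by
      simp only [Polynomial.IsRoot.def, Polynomial.eval_add, Polynomial.eval_mul,
        Polynomial.eval_C, Polynomial.eval_pow, Polynomial.eval_X] at ht
      linear_combination ht
    refine ⟨1, -t, a, c + a * t, ?_⟩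
    simp only [hb, Algebra.smul_def, map_neg, map_mul, map_add, map_one]
    ring

theorem substitution_eq_C_mul_X :
    (![C Complex.I * X 0, X 1, -(C Complex.I) * X 2, X 3] :
      Fin 4 → MvPolynomial (Fin 4) ℂ) =
    fun i => C ((![Complex.I, 1, -Complex.I, 1] : Fin 4 → ℂ) i) * X i := by
  funext i
  fin_cases i <;> simp

theorem mem_span_of_bihomogeneous_of_invariant {f : MvPolynomial (Fin 4) ℂ}
    (hz : IsWeightedHomogeneous (![1,1,0,0] : Fin 4 → ℕ) f 2)
    (hw : IsWeightedHomogeneous (![0,0,1,1] : Fin 4 → ℕ) f 2)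
    (hf : aeval ![C Complex.I * X 0, X 1, -(C Complex.I) * X 2,
      (X 3 : MvPolynomial (Fin 4) ℂ)] f = f) :
    f ∈ Submodule.span ℂ
      {(X 0 : MvPolynomial (Fin 4) ℂ) ^ 2 * X 2 ^ 2, X 1 ^ 2 * X 3 ^ 2,
        X 0 * X 1 * X 2 * X 3} := by
  rw [f.as_sum]
  refine Submodule.sum_mem _ fun d hd => ?_
  have hc : coeff d f ≠ 0 := mem_support_iff.mp hd
  have h1 := hz hc
  have h2 := hw hc
  have h3 : Complex.I ^ d 0 * (-Complex.I) ^ d 2 = 1 := by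
    have h := congrArg (coeff d) hf
    rw [substitution_eq_C_mul_X, coeff_aeval_C_mul_X] at h
    simpa [Fin.prod_univ_four] using mul_right_cancel₀ hc (h.trans (one_mul _).symm)
  rw [Finsupp.weight_apply, Finsupp.sum_fintype _ _ (by simp), Fin.sum_univ_four] at h1 h2
  simp only [smul_eq_mul, Matrix.cons_val, mul_one, mul_zero, add_zero, zero_add] at h1 h2
  have hm : monomial d (coeff d f) =
      coeff d f • ((X 0 : MvPolynomial (Fin 4) ℂ) ^ d 0 * X 1 ^ d 1 * X 2 ^ d 2 * X 3 ^ d 3) := by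
    rw [monomial_eq, Finsupp.prod_fintype _ _ (by simp), Fin.prod_univ_four, smul_eq_C_mul]
  rw [hm]
  refine Submodule.smul_mem _ _ (Submodule.subset_span ?_)
  have hcases : (d 0 = 2 ∧ d 1 = 0 ∨ d 0 = 0 ∧ d 1 = 2 ∨ d 0 = 1 ∧ d 1 = 1) ∧
      (d 2 = 2 ∧ d 3 = 0 ∨ d 2 = 0 ∧ d 3 = 2 ∨ d 2 = 1 ∧ d 3 = 1) := by omega
  obtain ⟨⟨e0, e1⟩ | ⟨e0, e1⟩ | ⟨e0, e1⟩, ⟨e2, e3⟩ | ⟨e2, e3⟩ | ⟨e2, e3⟩⟩ := hcases <;>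
    rw [e0, e2] at h3 <;> rw [e0, e1, e2, e3] <;>
    first
    | (exfalso; norm_num [Complex.ext_iff, pow_two] at h3; done)
    | simp

theorem isWeightedHomogeneous_smul_add_smul (p q : ℂ) :
    IsWeightedHomogeneous (![1,1,0,0] : Fin 4 → ℕ)
      (p • (X 0 * X 2) + q • (X 1 * X 3) : MvPolynomial (Fin 4) ℂ) 1 ∧
    IsWeightedHomogeneous (![0,0,1,1] : Fin 4 → ℕ)
      (p • (X 0 * X 2) + q • (X 1 * X 3) : MvPolynomial (Fin 4) ℂ) 1 := by
  have key (w : Fin 4 → ℕ) (h02 : w 0 + w 2 = 1) (h13 : w 1 + w 3 = 1) :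
      IsWeightedHomogeneous w
        (p • (X 0 * X 2) + q • (X 1 * X 3) : MvPolynomial (Fin 4) ℂ) 1 := by
    have hx := (isWeightedHomogeneous_X ℂ w 0).mul (isWeightedHomogeneous_X ℂ w 2)
    have hy := (isWeightedHomogeneous_X ℂ w 1).mul (isWeightedHomogeneous_X ℂ w 3)
    rw [h02] at hx
    rw [h13] at hy
    exact (weightedHomogeneousSubmodule ℂ w 1).add_mem
      ((weightedHomogeneousSubmodule ℂ w 1).smul_mem p hx)
      ((weightedHomogeneousSubmodule ℂ w 1).smul_mem q hy)
  exact ⟨key _ rfl rfl, key _ rfl rfl⟩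

theorem exists_mul_eq_of_mem_span {f : MvPolynomial (Fin 4) ℂ}
    (hf : f ∈ Submodule.span ℂ
      {(X 0 : MvPolynomial (Fin 4) ℂ) ^ 2 * X 2 ^ 2, X 1 ^ 2 * X 3 ^ 2,
        X 0 * X 1 * X 2 * X 3}) :
    ∃ p q r s : ℂ, f = (p • (X 0 * X 2) + q • (X 1 * X 3)) *
      (r • (X 0 * X 2) + s • (X 1 * X 3)) := by
  obtain ⟨a, b, c, rfl⟩ := Submodule.mem_span_triple.mp hf
  obtain ⟨p, q, r, s, h⟩ := exists_mul_eq_binary_quadratic_form a b c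
    (X 0 * X 2 : MvPolynomial (Fin 4) ℂ) (X 1 * X 3)
  refine ⟨p, q, r, s, h ▸ ?_⟩
  simp only [smul_eq_C_mul]
  ring

/-- Consider the `ℤ/4ℤ`-action on `ℂ[z1,z2,w1,w2]` induced by
`(z1,z2,w1,w2) ↦ (i·z1, z2, −i·w1, w2)` (variables `z1 = X 0`, `z2 = X 1`,
`w1 = X 2`, `w2 = X 3`).  The space of invariant bihomogeneous polynomials of
bidegree `(2,2)` is spanned by `z1²w1²`, `z2²w2²` and `z1z2w1w2`, and every member
of this space factors as a product of two bihomogeneous polynomials of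
bidegree `(1,1)`. -/
theorem stmt_6 :
    ({f : MvPolynomial (Fin 4) ℂ |
        IsWeightedHomogeneous (![1,1,0,0] : Fin 4 → ℕ) f 2 ∧
        IsWeightedHomogeneous (![0,0,1,1] : Fin 4 → ℕ) f 2 ∧
        aeval ![C Complex.I * X 0, X 1, -(C Complex.I) * X 2,
          (X 3 : MvPolynomial (Fin 4) ℂ)] f = f}
      = ↑(Submodule.span ℂ
          {(X 0 : MvPolynomial (Fin 4) ℂ) ^ 2 * X 2 ^ 2, X 1 ^ 2 * X 3 ^ 2,
            X 0 * X 1 * X 2 * X 3})) ∧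
    ∀ f : MvPolynomial (Fin 4) ℂ,
      IsWeightedHomogeneous (![1,1,0,0] : Fin 4 → ℕ) f 2 →
      IsWeightedHomogeneous (![0,0,1,1] : Fin 4 → ℕ) f 2 →
      aeval ![C Complex.I * X 0, X 1, -(C Complex.I) * X 2,
        (X 3 : MvPolynomial (Fin 4) ℂ)] f = f →
      ∃ g h : MvPolynomial (Fin 4) ℂ,
        IsWeightedHomogeneous (![1,1,0,0] : Fin 4 → ℕ) g 1 ∧
        IsWeightedHomogeneous (![0,0,1,1] : Fin 4 → ℕ) g 1 ∧
        IsWeightedHomogeneous (![1,1,0,0] : Fin 4 → ℕ) h 1 ∧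
        IsWeightedHomogeneous (![0,0,1,1] : Fin 4 → ℕ) h 1 ∧
        f = g * h := by
  refine ⟨Set.Subset.antisymm
    (fun f ⟨hz, hw, hf⟩ => mem_span_of_bihomogeneous_of_invariant hz hw hf) fun f hf => ?_,
    fun f hz hw hf => ?_⟩
  · obtain ⟨p, q, r, s, rfl⟩ := exists_mul_eq_of_mem_span hf
    refine ⟨?_, ?_, ?_⟩
    · exact (isWeightedHomogeneous_smul_add_smul p q).1.mul
        (isWeightedHomogeneous_smul_add_smul r s).1
    · exact (isWeightedHomogeneous_smul_add_smul p q).2.mul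
        (isWeightedHomogeneous_smul_add_smul r s).2
    · have hI : (C Complex.I * C Complex.I : MvPolynomial (Fin 4) ℂ) = -1 := by
        rw [← C_mul, Complex.I_mul_I, C_neg, C_1]
      have hx : (C Complex.I * X 0 * (-C Complex.I * X 2) : MvPolynomial (Fin 4) ℂ) =
          X 0 * X 2 := by
        linear_combination (-(X 0 * X 2)) * hI
      simp only [map_mul, map_add, map_smul, aeval_X, Matrix.cons_val, hx]
  · obtain ⟨p, q, r, s, rfl⟩ :=
      exists_mul_eq_of_mem_span (mem_span_of_bihomogeneous_of_invariant hz hw hf)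
    obtain ⟨hg, hg'⟩ := isWeightedHomogeneous_smul_add_smul p q
    obtain ⟨hh, hh'⟩ := isWeightedHomogeneous_smul_add_smul r s
    exact ⟨_, _, hg, hg', hh, hh', rfl⟩
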